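/- (Case 1: forward invariance of Π₃ for supercritical workload) Let y be a solution of the time-changed ODE with w₀ = τ₁y₁(0) + τ₂y₂(0) > w* and y(0) ∈ Π₃. Then y(t) ∈ Π₃ for all t ≥ 0; in particular y₁(t) ≥ K₁ for all t ≥ 0. -/

import Mathlib

/-- A solution of the time-changed ODE: a differentiable function `y : [0,∞) → ℝ₊²` with
`y′(t) = Ξ·(min(y₁(t),K₁), min(y₂(t),K₂))ᵀ` for all `t ≥ 0`. -/
def IsTCSolution (xi11 xi12 xi21 xi22 K1 K2 : ℝ) (y : ℝ → ℝ × ℝ) : Prop :=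
  ∀ t : ℝ, 0 ≤ t → 0 ≤ (y t).1 ∧ 0 ≤ (y t).2 ∧
    HasDerivWithinAt y
      (xi11 * min (y t).1 K1 + xi12 * min (y t).2 K2,
       xi21 * min (y t).1 K1 + xi22 * min (y t).2 K2) (Set.Ici 0) t

/-- A solution of `x = b + M x` with `M` entrywise nonnegative, `M ^ k → 0` and `b > 0` is
entrywise positive. -/
theorem pos_of_eq_add_mulVec {n : Type*} [Fintype n] [DecidableEq n] {M : Matrix n n ℝ}
    (hM : ∀ i j, 0 ≤ M i j)
    (hlim : Filter.Tendsto (fun k : ℕ => M ^ k) Filter.atTop (nhds 0))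
    {x b : n → ℝ} (hb : ∀ i, 0 < b i) (hx : x = b + M.mulVec x) (i : n) : 0 < x i := by
  have hMv : ∀ v : n → ℝ, 0 ≤ v → 0 ≤ M.mulVec v := fun v hv i =>
    Finset.sum_nonneg fun j _ => mul_nonneg (hM i j) (hv j)
  have hpow : ∀ k : ℕ, 0 ≤ (M ^ k).mulVec b := by
    intro k
    induction k with
    | zero =>
      rw [pow_zero, Matrix.one_mulVec]
      exact fun i => (hb i).le
    | succ k ih =>
      rw [pow_succ', ← Matrix.mulVec_mulVec]
      exact hMv _ ih
  have hle : ∀ k : ℕ, (M ^ k).mulVec x ≤ x := by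
    intro k
    induction k with
    | zero => simp
    | succ k ih =>
      have hk : (M ^ k).mulVec x = (M ^ k).mulVec b + (M ^ (k + 1)).mulVec x := by
        rw [pow_succ, ← Matrix.mulVec_mulVec, ← Matrix.mulVec_add, ← hx]
      refine le_trans ?_ ih
      rw [hk]
      exact le_add_of_nonneg_left (hpow k)
  have hx0 : 0 ≤ x := by
    have hcont : Continuous fun A : Matrix n n ℝ => A.mulVec x :=
      continuous_id.matrix_mulVec continuous_const
    have ht := (hcont.tendsto 0).comp hlim
    rw [Matrix.zero_mulVec] at ht
    exact le_of_tendsto' ht hle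
  have hi := congrFun hx i
  rw [hi]
  exact add_pos_of_pos_of_nonneg (hb i) (hMv x hx0 i)

/-- A function on `[0, ∞)` starting below `c`, with negative derivative whenever it
equals `c`, stays below `c`. -/
theorem le_const_of_hasDerivWithinAt_neg {f f' : ℝ → ℝ} {c : ℝ}
    (hf : ∀ t, 0 ≤ t → HasDerivWithinAt f (f' t) (Set.Ici 0) t) (h0 : f 0 ≤ c)
    (hneg : ∀ t, 0 ≤ t → f t = c → f' t < 0) {t : ℝ} (ht : 0 ≤ t) : f t ≤ c :=
  image_le_of_deriv_right_lt_deriv_boundary' (a := 0) (b := t) (B := fun _ => c)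
    (B' := fun _ => 0)
    (fun s hs => (hf s hs.1).continuousWithinAt.mono Set.Icc_subset_Ici_self)
    (fun s hs => (hf s hs.1).mono (Set.Ici_subset_Ici.2 hs.1)) h0 continuousOn_const
    (fun s _ => hasDerivWithinAt_const s _ c) (fun s hs => hneg s hs.1) ⟨ht, le_rfl⟩

/-- A function on `[0, ∞)` with vanishing derivative is constant. -/
theorem eq_initial_of_hasDerivWithinAt_zero {f : ℝ → ℝ}
    (hf : ∀ t, 0 ≤ t → HasDerivWithinAt f 0 (Set.Ici 0) t) {t : ℝ} (ht : 0 ≤ t) :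
    f t = f 0 :=
  constant_of_has_deriv_right_zero (a := 0) (b := t)
    (fun s hs => (hf s hs.1).continuousWithinAt.mono Set.Icc_subset_Ici_self)
    (fun s hs => (hf s hs.1).mono (Set.Ici_subset_Ici.2 hs.1)) t ⟨ht, le_rfl⟩

/-- Case 1: for supercritical workload, region `Π₃` is forward invariant. -/
theorem tc_ode_region3_forward_invariant
    (lam1 lam2 mu1 mu2 : ℝ)
    (hlam1 : 0 < lam1) (hlam2 : 0 < lam2) (hmu1 : 0 < mu1) (hmu2 : 0 < mu2)
    (p11 p12 p21 p22 : ℝ)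
    (hp11 : 0 ≤ p11) (hp12 : 0 ≤ p12) (hp21 : 0 ≤ p21) (hp22 : 0 ≤ p22)
    (hrow1 : p11 + p12 ≤ 1) (hrow2 : p21 + p22 ≤ 1)
    (hspec : Filter.Tendsto
      (fun k : ℕ => (Matrix.of ![![p11, p12], ![p21, p22]] : Matrix (Fin 2) (Fin 2) ℝ) ^ k)
      Filter.atTop (nhds 0))
    (gam1 gam2 : ℝ)
    (hgam1 : gam1 = lam1 + p11 * gam1 + p21 * gam2)
    (hgam2 : gam2 = lam2 + p12 * gam1 + p22 * gam2)
    (rho1 rho2 : ℝ) (hrho1 : rho1 = gam1 / mu1) (hrho2 : rho2 = gam2 / mu2)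
    (tau1 tau2 : ℝ)
    (htau1 : tau1 = 1 / mu1 + p11 * tau1 + p12 * tau2)
    (htau2 : tau2 = 1 / mu2 + p21 * tau1 + p22 * tau2)
    (hcrit : rho1 + rho2 = 1)
    (K1 K2 : ℝ) (hK1 : 0 < K1) (hK2 : 0 < K2)
    (hbot : rho1 / K1 > rho2 / K2)
    (xi11 xi12 xi21 xi22 : ℝ)
    (hxi11 : xi11 = lam1 + mu1 * p11 - mu1)
    (hxi12 : xi12 = lam1 + mu2 * p21)
    (hxi21 : xi21 = lam2 + mu1 * p12)
    (hxi22 : xi22 = lam2 + mu2 * p22 - mu2)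
    (wstar : ℝ) (hwstar : wstar = tau1 * K1 + tau2 * (rho2 / rho1) * K1)
    (y : ℝ → ℝ × ℝ) (hy : IsTCSolution xi11 xi12 xi21 xi22 K1 K2 y)
    (w0 : ℝ) (hw0 : w0 = tau1 * (y 0).1 + tau2 * (y 0).2)
    (hsup : w0 > wstar)
    (h0 : K1 ≤ (y 0).1 ∧ (y 0).2 ≤ K2) :
    ∀ t : ℝ, 0 ≤ t → K1 ≤ (y t).1 ∧ (y t).2 ≤ K2 := by
  set M : Matrix (Fin 2) (Fin 2) ℝ := Matrix.of ![![p11, p12], ![p21, p22]] with hM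
  have hM0 : ∀ i j, 0 ≤ M i j := by
    intro i j
    fin_cases i <;> fin_cases j <;> simpa [hM]
  have hspecT : Filter.Tendsto (fun k : ℕ => M.transpose ^ k) Filter.atTop (nhds 0) := by
    have hT := ((continuous_id.matrix_transpose :
      Continuous fun A : Matrix (Fin 2) (Fin 2) ℝ => A.transpose).tendsto 0).comp hspec
    simpa [Function.comp_def, Matrix.transpose_pow] using hT
  have hgam := pos_of_eq_add_mulVec (fun i j => hM0 j i) hspecT (x := ![gam1, gam2])
    (b := ![lam1, lam2])
    (by intro i; fin_cases i <;> simpa)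
    (by
      ext i
      fin_cases i <;> simp [hM, Matrix.mulVec, dotProduct, Fin.sum_univ_two] <;> linarith)
  have htau := pos_of_eq_add_mulVec hM0 hspec (x := ![tau1, tau2]) (b := ![1 / mu1, 1 / mu2])
    (by intro i; fin_cases i <;> simpa)
    (by
      ext i
      fin_cases i <;> simp [hM] <;>
        simp only [one_div] at htau1 htau2 <;> linarith)
  have hg1 : 0 < gam1 := hgam 0
  have hg2 : 0 < gam2 := hgam 1
  have ht2 : 0 < tau2 := htau 1
  have hr1 : 0 < rho1 := hrho1 ▸ div_pos hg1 hmu1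
  have hr2 : 0 < rho2 := hrho2 ▸ div_pos hg2 hmu2
  have hgr1 : gam1 = rho1 * mu1 := by rw [hrho1]; field_simp
  have hgr2 : gam2 = rho2 * mu2 := by rw [hrho2]; field_simp
  have hker1 : xi11 * rho1 + xi12 * rho2 = 0 := by
    rw [hgr1, hgr2] at hgam1
    rw [hxi11, hxi12]
    linear_combination lam1 * hcrit - hgam1
  have hker2 : xi21 * rho1 + xi22 * rho2 = 0 := by
    rw [hgr1, hgr2] at hgam2
    rw [hxi21, hxi22]
    linear_combination lam2 * hcrit - hgam2
  have hx12 : 0 < xi12 := by rw [hxi12]; positivity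
  have hx21 : 0 < xi21 := by rw [hxi21]; positivity
  have hm1 : mu1 * tau1 = 1 + mu1 * (p11 * tau1 + p12 * tau2) := by
    have : mu1 * (1 / mu1) = 1 := by field_simp
    linear_combination mu1 * htau1 + this
  have hm2 : mu2 * tau2 = 1 + mu2 * (p21 * tau1 + p22 * tau2) := by
    have : mu2 * (1 / mu2) = 1 := by field_simp
    linear_combination mu2 * htau2 + this
  have hload : tau1 * lam1 + tau2 * lam2 = 1 := by
    rw [hgr1, hgr2] at hgam1 hgam2
    linear_combination (-tau1) * hgam1 - tau2 * hgam2 + rho1 * hm1 + rho2 * hm2 + hcrit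
  have hleft1 : tau1 * xi11 + tau2 * xi21 = 0 := by
    rw [hxi11, hxi21]
    linear_combination hload - hm1
  have hleft2 : tau1 * xi12 + tau2 * xi22 = 0 := by
    rw [hxi12, hxi22]
    linear_combination hload - hm2
  have hd1 : ∀ t, 0 ≤ t → HasDerivWithinAt (fun s => (y s).1)
      (xi11 * min (y t).1 K1 + xi12 * min (y t).2 K2) (Set.Ici 0) t :=
    fun t ht => (hy t ht).2.2.fst
  have hd2 : ∀ t, 0 ≤ t → HasDerivWithinAt (fun s => (y s).2)
      (xi21 * min (y t).1 K1 + xi22 * min (y t).2 K2) (Set.Ici 0) t :=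
    fun t ht => (hy t ht).2.2.snd
  have hw : ∀ t, 0 ≤ t → tau1 * (y t).1 + tau2 * (y t).2 = w0 := by
    intro t ht
    rw [hw0]
    refine eq_initial_of_hasDerivWithinAt_zero
      (f := fun s => tau1 * (y s).1 + tau2 * (y s).2) (fun s hs => ?_) ht
    refine (((hd1 s hs).const_mul tau1).add ((hd2 s hs).const_mul tau2)).congr_deriv ?_
    linear_combination min (y s).1 K1 * hleft1 + min (y s).2 K2 * hleft2
  have hbot' : rho2 * K1 < rho1 * K2 := (div_lt_div_iff₀ hK2 hK1).1 hbot
  intro t ht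
  constructor
  · refine neg_le_neg_iff.1 (le_const_of_hasDerivWithinAt_neg (f := fun s => -(y s).1)
      (fun s hs => (hd1 s hs).neg) (neg_le_neg h0.1) (fun s hs hsK => ?_) ht)
    have hy1 : (y s).1 = K1 := neg_injective hsK
    have hwork := hw s hs
    rw [hy1] at hwork
    have hy2 : rho2 / rho1 * K1 < (y s).2 := by
      refine lt_of_mul_lt_mul_left ?_ ht2.le
      linarith
    have hK : rho2 / rho1 * K1 < K2 := by
      rw [div_mul_eq_mul_div, div_lt_iff₀ hr1]
      linarith
    have hx11 : xi11 = -(xi12 * (rho2 / rho1)) := by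
      field_simp
      linarith
    have hpos := mul_pos hx12 (sub_pos.2 (lt_min hy2 hK))
    rw [hy1, min_self, hx11]
    linarith
  · refine le_const_of_hasDerivWithinAt_neg hd2 h0.2 (fun s hs hsK => ?_) ht
    rw [hsK, min_self]
    have hmin : xi21 * min (y s).1 K1 ≤ xi21 * K1 :=
      mul_le_mul_of_nonneg_left (min_le_right _ _) hx21.le
    have hneg : xi21 * K1 + xi22 * K2 < 0 := by
      refine neg_of_mul_neg_right (a := rho2) ?_ hr2.le
      have hpos := mul_pos hx21 (sub_pos.2 hbot')
      linear_combination hpos + K2 * hker2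
    linarith
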